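/- arXiv:1901.06689 — 6 statements merged into one kernel-verified Lean document; each statement's English description precedes it below -/
import Mathlib

section
/- For all complex numbers λ and μ with λ ≠ 0 and μ ≠ 0, the polynomial λ·r²·v + μ³·r·v⁶ − 1 is irreducible in the polynomial ring ℂ[r, v]. -/
open MvPolynomial

lemma const_unit_aux {R : Type*} [CommRing R] [IsDomain R] (g h f : Polynomial R)
    (hf0 : f.coeff 0 = -1) (e : f = g * h) (hg : g.natDegree = 0) : IsUnit g := by
  rw [Polynomial.eq_C_of_natDegree_eq_zero hg] at e ⊢
  rw [Polynomial.isUnit_C]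
  have h0 := congrArg (fun q => Polynomial.coeff q 0) e
  simp only [hf0, Polynomial.coeff_C_mul] at h0
  exact IsUnit.of_mul_eq_one (-(h.coeff 0)) (by linear_combination h0)

/-- Reversed Eisenstein criterion in degree two. -/
lemma quad_aux {R : Type*} [CommRing R] [IsDomain R] (p u w : R) (hp : Prime p) (hu : IsUnit u) :
    Irreducible (Polynomial.C (u * p) * Polynomial.X ^ 2 + Polynomial.C (p * w) * Polynomial.X
      + Polynomial.C (-1) : Polynomial R) := by
  have hup : u * p ≠ 0 := mul_ne_zero hu.ne_zero hp.ne_zero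
  set f : Polynomial R := Polynomial.C (u * p) * Polynomial.X ^ 2 +
    Polynomial.C (p * w) * Polynomial.X + Polynomial.C (-1) with hf
  have hd : f.natDegree = 2 := Polynomial.natDegree_quadratic hup
  have c0 : f.coeff 0 = -1 := by simp [hf]
  have c1 : f.coeff 1 = p * w := by simp [hf, -map_mul, -map_add, Polynomial.coeff_X, Polynomial.coeff_one]
  have c2 : f.coeff 2 = u * p := by
    simp [hf, -map_mul, -map_add, Polynomial.coeff_X, Polynomial.coeff_one, Polynomial.coeff_C]
  have hfne : f ≠ 0 := by
    intro h
    simp [h] at hd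
  constructor
  · intro h
    have := Polynomial.natDegree_eq_zero_of_isUnit h
    omega
  · intro g h e
    have hgh : g * h ≠ 0 := e ▸ hfne
    have hs : g.natDegree + h.natDegree = 2 := by
      rw [← Polynomial.natDegree_mul (left_ne_zero_of_mul hgh) (right_ne_zero_of_mul hgh), ← e, hd]
    by_cases hg : g.natDegree = 0
    · exact Or.inl (const_unit_aux g h f c0 e hg)
    by_cases hh : h.natDegree = 0
    · exact Or.inr (const_unit_aux h g f c0 (by rw [e, mul_comm]) hh)
    exfalso
    have hg1 : g.natDegree ≤ 1 := by omega
    have hh1 : h.natDegree ≤ 1 := by omega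
    obtain ⟨a, b, rfl⟩ := Polynomial.exists_eq_X_add_C_of_natDegree_le_one hg1
    obtain ⟨c, d, rfl⟩ := Polynomial.exists_eq_X_add_C_of_natDegree_le_one hh1
    have e' : f = Polynomial.C (a * c) * Polynomial.X ^ 2 +
        Polynomial.C (a * d + b * c) * Polynomial.X + Polynomial.C (b * d) := by
      rw [e]; simp only [map_mul, map_add]; ring
    have e0 : b * d = -1 := by rw [← c0, e']; simp
    have e1 : a * d + b * c = p * w := by
      rw [← c1, e']; simp [Polynomial.coeff_X, Polynomial.coeff_C, -map_mul, -map_add]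
    have e2 : a * c = u * p := by
      rw [← c2, e']; simp [Polynomial.coeff_X, Polynomial.coeff_C, -map_mul, -map_add]
    have both : p ∣ a ∧ p ∣ c := by
      rcases hp.dvd_or_dvd (Dvd.intro_left u e2.symm) with ⟨k, hk⟩ | ⟨k, hk⟩
      · exact ⟨⟨k, hk⟩, ⟨d * (k * d - w), by
          subst hk; linear_combination c * e0 - d * e1⟩⟩
      · exact ⟨⟨b * (k * b - w), by
          subst hk; linear_combination a * e0 - b * e1⟩, ⟨k, hk⟩⟩
    obtain ⟨⟨s, rfl⟩, ⟨t, rfl⟩⟩ := both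
    have : p * (s * t) = u := mul_left_cancel₀ hp.ne_zero (by linear_combination e2)
    exact hp.not_isUnit (isUnit_of_dvd_unit (Dvd.intro _ this) hu)

/-- For all complex numbers `l` (= λ) and `m` (= μ) with `l ≠ 0` and `m ≠ 0`,
the polynomial `λ·r²·v + μ³·r·v⁶ − 1` is irreducible in `ℂ[r, v]`,
where `r = X 0` and `v = X 1`. -/
theorem stmt_0 (l m : ℂ) (hl : l ≠ 0) (hm : m ≠ 0) :
    Irreducible
      ((C l * X 0 ^ 2 * X 1 + C (m ^ 3) * X 0 * X 1 ^ 6 - 1 :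
        MvPolynomial (Fin 2) ℂ)) := by
  rw [← MulEquiv.irreducible_iff (finSuccEquiv ℂ 1)]
  have key := quad_aux (R := MvPolynomial (Fin 1) ℂ) (X 0) (C l) (C (m ^ 3) * X 0 ^ 5)
    MvPolynomial.X_prime (hl.isUnit.map C)
  convert key using 1
  have h1 : finSuccEquiv ℂ 1 (X 1) = Polynomial.C (X 0) := finSuccEquiv_X_succ (j := 0)
  have hC (a : ℂ) : finSuccEquiv ℂ 1 (C a) = Polynomial.C (C a) := by
    simp [finSuccEquiv_apply]
  simp only [map_sub, map_add, map_mul, map_pow, map_one, map_neg, h1, hC, finSuccEquiv_X_zero]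
  ring
end

section
/- For all complex numbers λ, μ, ν with μ·ν ≠ 0, the polynomial r − λν·r²·t + μ²ν²·t⁶ is irreducible in the polynomial ring ℂ[r, t]. -/
open MvPolynomial

lemma aux_unit {R : Type*} [CommRing R] [IsDomain R] (A B : R) (g h : Polynomial R)
    (hF : Polynomial.X + Polynomial.C A * Polynomial.X ^ 2 + Polynomial.C B = g * h)
    (hg : g.natDegree = 0) : IsUnit g := by
  rw [Polynomial.eq_C_of_natDegree_eq_zero hg] at hF ⊢
  have h1 := congrArg (fun p => Polynomial.coeff p 1) hF
  simp [Polynomial.coeff_X_pow, Polynomial.coeff_C] at h1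
  exact Polynomial.isUnit_C.mpr (IsUnit.of_mul_eq_one _ h1.symm)

lemma aux_irred {R : Type*} [CommRing R] [IsDomain R] (A B : R)
    (hs : A ≠ 0 → ∀ s : R, s ^ 2 ≠ 1 - 4 * A * B) :
    Irreducible (Polynomial.X + Polynomial.C A * Polynomial.X ^ 2 + Polynomial.C B :
      Polynomial R) := by
  set F : Polynomial R :=
    Polynomial.X + Polynomial.C A * Polynomial.X ^ 2 + Polynomial.C B with hFdef
  have c1 : F.coeff 1 = 1 := by simp [hFdef, Polynomial.coeff_X_pow, Polynomial.coeff_C]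
  have c0 : F.coeff 0 = B := by simp [hFdef]
  have c2 : F.coeff 2 = A := by
    simp [hFdef, Polynomial.coeff_X, Polynomial.coeff_C]
  have hF0 : F ≠ 0 := by
    intro h
    rw [h] at c1
    simp at c1
  have hdeg : F.natDegree ≤ 2 := by
    rw [hFdef]
    compute_degree
  refine ⟨fun hu => ?_, fun g h hgh => ?_⟩
  · have := Polynomial.natDegree_eq_zero_of_isUnit hu
    rw [Polynomial.coeff_eq_zero_of_natDegree_lt (by omega)] at c1
    exact zero_ne_one c1
  · have hg0 : g ≠ 0 := by rintro rfl; simp [hgh] at hF0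
    have hh0 : h ≠ 0 := by rintro rfl; simp [hgh] at hF0
    have hd := Polynomial.natDegree_mul hg0 hh0
    rw [← hgh] at hd
    by_cases h1 : g.natDegree = 0
    · exact Or.inl (aux_unit A B g h hgh h1)
    by_cases h2 : h.natDegree = 0
    · exact Or.inr (aux_unit A B h g (hgh.trans (mul_comm g h)) h2)
    exfalso
    have g1 : g.natDegree ≤ 1 := by omega
    have k1 : h.natDegree ≤ 1 := by omega
    obtain ⟨p, q, hg⟩ := Polynomial.exists_eq_X_add_C_of_natDegree_le_one g1
    obtain ⟨s, u, hh⟩ := Polynomial.exists_eq_X_add_C_of_natDegree_le_one k1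
    have e : F = Polynomial.C (p * s) * Polynomial.X ^ 2
        + Polynomial.C (p * u + q * s) * Polynomial.X + Polynomial.C (q * u) := by
      rw [hgh, hg, hh]
      simp only [Polynomial.C_mul, Polynomial.C_add]
      ring
    rw [e] at c0 c1 c2
    simp [Polynomial.coeff_X, Polynomial.coeff_C, Polynomial.coeff_X_pow,
      -map_mul, -map_add] at c0 c1 c2
    have hp : p ≠ 0 := by
      rintro rfl
      apply h1
      simp [hg]
    have hs0 : s ≠ 0 := by
      rintro rfl
      apply h2
      simp [hh]
    apply hs (by rw [← c2]; exact mul_ne_zero hp hs0) (p * u - q * s)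
    rw [← c0, ← c2]
    linear_combination (p * u + q * s + 1) * c1

/-- For all complex numbers `l` (= λ), `m` (= μ), `n` (= ν) with `μ·ν ≠ 0`,
the polynomial `r − λν·r²·t + μ²ν²·t⁶` is irreducible in `ℂ[r, t]`,
where `r = X 0` and `t = X 1`. -/
theorem stmt_1 (l m n : ℂ) (hmn : m * n ≠ 0) :
    Irreducible
      ((X 0 - C (l * n) * X 0 ^ 2 * X 1 + C (m ^ 2 * n ^ 2) * X 1 ^ 6 :
        MvPolynomial (Fin 2) ℂ)) := by
  have hn : n ≠ 0 := right_ne_zero_of_mul hmn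
  have hm : m ≠ 0 := left_ne_zero_of_mul hmn
  rw [← MulEquiv.irreducible_iff (finSuccEquiv ℂ 1)]
  have key := aux_irred (R := MvPolynomial (Fin 1) ℂ) (-(C (l * n) * X 0))
    (C (m ^ 2 * n ^ 2) * X 0 ^ 6) (by
      intro hA s hs
      have hl : l ≠ 0 := by
        rintro rfl
        simp at hA
      have h := congrArg (aeval (fun _ : Fin 1 => (Polynomial.X : Polynomial ℂ))) hs
      have h2 : (aeval (fun _ : Fin 1 => (Polynomial.X : Polynomial ℂ)) s) ^ 2 =
          Polynomial.C (4 * (l * n) * (m ^ 2 * n ^ 2)) * Polynomial.X ^ 7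
            + Polynomial.C 1 := by
        rw [← map_pow, h]
        simp only [map_sub, map_mul, map_neg, map_one, map_pow, aeval_X, algHom_C, map_ofNat,
          Polynomial.algebraMap_eq]
        ring
      have h3 := congrArg Polynomial.natDegree h2
      rw [Polynomial.natDegree_pow, Polynomial.natDegree_add_C,
        Polynomial.natDegree_C_mul_X_pow _ _ (by simp [hl, hm, hn])] at h3
      omega)
  convert key using 1
  have hX1 : finSuccEquiv ℂ 1 (X 1) = Polynomial.C (X 0) := finSuccEquiv_X_succ (j := 0)
  have hC : ∀ c : ℂ, finSuccEquiv ℂ 1 (C c) = Polynomial.C (C c) := fun c => by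
    simp [finSuccEquiv_apply]
  simp only [map_add, map_sub, map_mul, map_pow, map_neg, finSuccEquiv_X_zero, hX1, hC]
  ring
end

section
/- For all complex numbers λ and μ with λ ≠ 0 and μ ≠ 0, and every point (r, s, t, u, v) ∈ ℂ⁵, the nine equations t² + μsu = 0, ut + sv = 0, tv − μu² = 0, s + u² = 0, t − uv = 0, −μu + v² = 0, rs² − u + λtr² = 0, λμr²u − (v + str) = 0, and rsu − λvr² + 1 = 0 hold simultaneously if and only if u = μ⁻¹v², t = μ⁻¹v³, s = −μ⁻²v⁴, and λμ³r²v + rv⁶ − μ³ = 0. -/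
/-- For all complex numbers `l` (= λ), `m` (= μ) with `λ ≠ 0`, `μ ≠ 0` and every
point `(r, s, t, u, v) ∈ ℂ⁵`, the nine equations hold simultaneously iff
`u = μ⁻¹v²`, `t = μ⁻¹v³`, `s = −μ⁻²v⁴` and `λμ³r²v + rv⁶ − μ³ = 0`. -/
theorem stmt_3 (l m : ℂ) (hl : l ≠ 0) (hm : m ≠ 0) (r s t u v : ℂ) :
    (t ^ 2 + m * s * u = 0 ∧
     u * t + s * v = 0 ∧
     t * v - m * u ^ 2 = 0 ∧
     s + u ^ 2 = 0 ∧
     t - u * v = 0 ∧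
     -(m * u) + v ^ 2 = 0 ∧
     r * s ^ 2 - u + l * t * r ^ 2 = 0 ∧
     l * m * r ^ 2 * u - (v + s * t * r) = 0 ∧
     r * s * u - l * v * r ^ 2 + 1 = 0) ↔
    (u = m⁻¹ * v ^ 2 ∧ t = m⁻¹ * v ^ 3 ∧ s = -((m ^ 2)⁻¹ * v ^ 4) ∧
     l * m ^ 3 * r ^ 2 * v + r * v ^ 6 - m ^ 3 = 0) := by
  constructor
  · rintro ⟨-, -, -, h4, h5, h6, -, -, h9⟩
    have hs : s = -u ^ 2 := by linear_combination h4
    have ht : t = u * v := by linear_combination h5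
    have hu : u = m⁻¹ * v ^ 2 := by
      field_simp
      linear_combination -h6
    have hv : v ^ 2 = m * u := by linear_combination h6
    have hv6 : v ^ 6 = m ^ 3 * u ^ 3 := by
      calc v ^ 6 = (v ^ 2) ^ 3 := by ring
        _ = m ^ 3 * u ^ 3 := by rw [hv]; ring
    refine ⟨hu, ?_, ?_, ?_⟩
    · rw [ht, hu]; ring
    · rw [hs, hu, ← inv_pow]; ring
    · rw [hs] at h9
      rw [hv6]
      linear_combination -m ^ 3 * h9
  · rintro ⟨hu, ht, hs, h⟩
    have hv : v ^ 2 = m * u := by rw [hu]; field_simp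
    have ht' : t = u * v := by rw [ht, hu]; ring
    have hs' : s = -u ^ 2 := by rw [hs, hu, ← inv_pow]; ring
    have hv6 : v ^ 6 = m ^ 3 * u ^ 3 := by
      calc v ^ 6 = (v ^ 2) ^ 3 := by ring
        _ = m ^ 3 * u ^ 3 := by rw [hv]; ring
    have h9 : -r * u ^ 3 - l * v * r ^ 2 + 1 = 0 := by
      have : m ^ 3 * (-r * u ^ 3 - l * v * r ^ 2 + 1) = 0 := by
        rw [hv6] at h
        linear_combination -h
      exact (mul_eq_zero.mp this).resolve_left (pow_ne_zero 3 hm)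
    clear hu ht hs h
    subst ht' hs'
    refine ⟨?_, ?_, ?_, ?_, ?_, ?_, ?_, ?_, ?_⟩
    · linear_combination u ^ 2 * hv
    · ring
    · linear_combination u * hv
    · ring
    · ring
    · linear_combination hv
    · linear_combination -u * h9
    · linear_combination -v * h9 - l * r ^ 2 * hv
    · linear_combination h9
end

section
/- For all complex numbers λ and μ with λ ≠ 0 and μ ≠ 0, the set of points (r, s, t, u, v, w) ∈ ℂ⁶ with w = 0 satisfying the nine equations t² + μsu = 0, ut + sv = 0, tv − μu² = 0, ws + u² = 0, tw − uv = 0, −μuw + v² = 0, rs² − wu + λtr² = 0, λμr²u − (vw + str) = 0, and rsu − λvr² + w² = 0 is exactly the set {(r, s, 0, 0, 0, 0) : r, s ∈ ℂ, r·s = 0}. -/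
/-- For all complex numbers `l` (= λ) and `m` (= μ) with `λ ≠ 0` and `μ ≠ 0`,
the set of points `(r, s, t, u, v, w) ∈ ℂ⁶` with `w = 0` satisfying the nine
equations is exactly `{(r, s, 0, 0, 0, 0) : r·s = 0}`. -/
theorem stmt_4 (l m : ℂ) (hl : l ≠ 0) (hm : m ≠ 0) :
    {x : ℂ × ℂ × ℂ × ℂ × ℂ × ℂ |
      match x with
      | (r, s, t, u, v, w) =>
        w = 0 ∧
        t ^ 2 + m * s * u = 0 ∧
        u * t + s * v = 0 ∧
        t * v - m * u ^ 2 = 0 ∧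
        w * s + u ^ 2 = 0 ∧
        t * w - u * v = 0 ∧
        -(m * u * w) + v ^ 2 = 0 ∧
        r * s ^ 2 - w * u + l * t * r ^ 2 = 0 ∧
        l * m * r ^ 2 * u - (v * w + s * t * r) = 0 ∧
        r * s * u - l * v * r ^ 2 + w ^ 2 = 0} =
    {x : ℂ × ℂ × ℂ × ℂ × ℂ × ℂ |
      ∃ r s : ℂ, r * s = 0 ∧ x = (r, s, 0, 0, 0, 0)} := by
  ext ⟨r, s, t, u, v, w⟩
  simp only [Set.mem_setOf_eq]
  constructor
  · rintro ⟨hw, h1, h2, h3, h4, h5, h6, h7, h8, h9⟩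
    subst hw
    have hu : u = 0 := by simpa using h4
    subst hu
    have hv : v = 0 := by simpa using h6
    subst hv
    have ht : t = 0 := by simpa using h1
    subst ht
    refine ⟨r, s, ?_, rfl⟩
    simpa using h7
  · rintro ⟨r', s', h, hx⟩
    simp only [Prod.mk.injEq] at hx
    obtain ⟨rfl, rfl, rfl, rfl, rfl, rfl⟩ := hx
    have h' : r * s ^ 2 = 0 := by rw [pow_two, ← mul_assoc, h, zero_mul]
    simp [h']
end

section
/- For all complex numbers λ and μ with λ ≠ 0 and μ ≠ 0, the set of points (s, t, u, v, w) ∈ ℂ⁵ satisfying the four equations ws + u² = 0, s² + λt = 0, λμu − st = 0, and su − λv = 0 is exactly the union {(0, 0, 0, 0, w) : w ∈ ℂ} ∪ {(s, −λ⁻¹s², −λ⁻²μ⁻¹s³, −λ⁻³μ⁻¹s⁴, −λ⁻⁴μ⁻²s⁵) : s ∈ ℂ}. -/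
/-- For all complex numbers `l` (= λ) and `m` (= μ) with `λ ≠ 0` and `μ ≠ 0`,
the set of points `(s, t, u, v, w) ∈ ℂ⁵` satisfying the four equations
`ws + u² = 0`, `s² + λt = 0`, `λμu − st = 0`, `su − λv = 0` is exactly the
union of the `w`-axis and the parametrized curve
`s ↦ (s, −λ⁻¹s², −λ⁻²μ⁻¹s³, −λ⁻³μ⁻¹s⁴, −λ⁻⁴μ⁻²s⁵)`. -/
theorem stmt_5 (l m : ℂ) (hl : l ≠ 0) (hm : m ≠ 0) :
    {x : ℂ × ℂ × ℂ × ℂ × ℂ |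
      match x with
      | (s, t, u, v, w) =>
        w * s + u ^ 2 = 0 ∧
        s ^ 2 + l * t = 0 ∧
        l * m * u - s * t = 0 ∧
        s * u - l * v = 0} =
    {x : ℂ × ℂ × ℂ × ℂ × ℂ | ∃ w : ℂ, x = (0, 0, 0, 0, w)} ∪
    {x : ℂ × ℂ × ℂ × ℂ × ℂ |
      ∃ s : ℂ, x = (s, -(l⁻¹ * s ^ 2), -((l ^ 2)⁻¹ * m⁻¹ * s ^ 3),
        -((l ^ 3)⁻¹ * m⁻¹ * s ^ 4), -((l ^ 4)⁻¹ * (m ^ 2)⁻¹ * s ^ 5))} := by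
  ext ⟨s, t, u, v, w⟩
  simp only [Set.mem_setOf_eq, Set.mem_union, Prod.mk.injEq]
  constructor
  · rintro ⟨h1, h2, h3, h4⟩
    have ht : t = -(l⁻¹ * s ^ 2) := by
      apply mul_left_cancel₀ hl
      have e : l * -(l⁻¹ * s ^ 2) = -s ^ 2 := by field_simp
      rw [e]
      linear_combination h2
    have hu : u = -((l ^ 2)⁻¹ * m⁻¹ * s ^ 3) := by
      apply mul_left_cancel₀ (mul_ne_zero (pow_ne_zero 2 hl) hm)
      have e : l ^ 2 * m * -((l ^ 2)⁻¹ * m⁻¹ * s ^ 3) = -s ^ 3 := by field_simp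
      rw [e]
      linear_combination l * h3 + s * h2
    have hv : v = -((l ^ 3)⁻¹ * m⁻¹ * s ^ 4) := by
      apply mul_left_cancel₀ hl
      have e : l * -((l ^ 3)⁻¹ * m⁻¹ * s ^ 4) = s * u := by
        rw [hu]
        field_simp
      rw [e]
      linear_combination -h4
    by_cases hs : s = 0
    · left
      subst hs
      exact ⟨w, rfl, by simpa using ht, by simpa using hu, by simpa using hv, rfl⟩
    · right
      refine ⟨s, rfl, ht, hu, hv, ?_⟩
      apply mul_right_cancel₀ hs
      have e : -((l ^ 4)⁻¹ * (m ^ 2)⁻¹ * s ^ 5) * s = -u ^ 2 := by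
        rw [hu]
        field_simp
      rw [e]
      linear_combination h1
  · rintro (⟨w', rfl, rfl, rfl, rfl, rfl⟩ | ⟨s', rfl, rfl, rfl, rfl, rfl⟩)
    · simp
    · refine ⟨?_, ?_, ?_, ?_⟩ <;> field_simp <;> ring
end

section
/- For all complex numbers λ and μ with λ ≠ 0 and μ ≠ 0, the set of points (s, t, u, v, w) ∈ ℂ⁵ satisfying the four equations μtv + sw = 0, λμt − s² = 0, λu + st = 0, and λv + t² = 0 is exactly the union {(0, 0, 0, 0, w) : w ∈ ℂ} ∪ {(s, λ⁻¹μ⁻¹s², −λ⁻²μ⁻¹s³, −λ⁻³μ⁻²s⁴, λ⁻⁴μ⁻²s⁵) : s ∈ ℂ}. -/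
/-- For all complex numbers `l` (= λ) and `m` (= μ) with `λ ≠ 0` and `μ ≠ 0`,
the set of points `(s, t, u, v, w) ∈ ℂ⁵` satisfying the four equations
`μtv + sw = 0`, `λμt − s² = 0`, `λu + st = 0`, `λv + t² = 0` is exactly the
union of the `w`-axis and the parametrized curve
`s ↦ (s, λ⁻¹μ⁻¹s², −λ⁻²μ⁻¹s³, −λ⁻³μ⁻²s⁴, λ⁻⁴μ⁻²s⁵)`. -/
theorem stmt_6 (l m : ℂ) (hl : l ≠ 0) (hm : m ≠ 0) :
    {x : ℂ × ℂ × ℂ × ℂ × ℂ |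
      match x with
      | (s, t, u, v, w) =>
        m * t * v + s * w = 0 ∧
        l * m * t - s ^ 2 = 0 ∧
        l * u + s * t = 0 ∧
        l * v + t ^ 2 = 0} =
    {x : ℂ × ℂ × ℂ × ℂ × ℂ | ∃ w : ℂ, x = (0, 0, 0, 0, w)} ∪
    {x : ℂ × ℂ × ℂ × ℂ × ℂ |
      ∃ s : ℂ, x = (s, l⁻¹ * m⁻¹ * s ^ 2, -((l ^ 2)⁻¹ * m⁻¹ * s ^ 3),
        -((l ^ 3)⁻¹ * (m ^ 2)⁻¹ * s ^ 4), (l ^ 4)⁻¹ * (m ^ 2)⁻¹ * s ^ 5)} := by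
  ext ⟨s, t, u, v, w⟩
  simp only [Set.mem_setOf_eq, Set.mem_union, Prod.mk.injEq]
  constructor
  · rintro ⟨h1, h2, h3, h4⟩
    have ht : t = l⁻¹ * m⁻¹ * s ^ 2 := by
      field_simp
      linear_combination h2
    have hu : u = -((l ^ 2)⁻¹ * m⁻¹ * s ^ 3) := by
      have : u = -(l⁻¹ * (s * t)) := by
        field_simp
        linear_combination h3
      rw [this, ht]
      field_simp
    have hv : v = -((l ^ 3)⁻¹ * (m ^ 2)⁻¹ * s ^ 4) := by
      have : v = -(l⁻¹ * t ^ 2) := by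
        field_simp
        linear_combination h4
      rw [this, ht]
      field_simp
    by_cases hs : s = 0
    · left
      subst hs
      exact ⟨w, rfl, by simpa using ht, by simpa using hu, by simpa using hv, rfl⟩
    · right
      refine ⟨s, rfl, ht, hu, hv, ?_⟩
      apply mul_left_cancel₀ hs
      have : s * w = -(m * t * v) := by linear_combination h1
      rw [this, ht, hv]
      field_simp
  · rintro (⟨w', rfl, rfl, rfl, rfl, rfl⟩ | ⟨s', rfl, rfl, rfl, rfl, rfl⟩)
    · simp
    · refine ⟨?_, ?_, ?_, ?_⟩ <;> field_simp <;> ring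
end
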